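/- Let k ≥ 1 be a positive integer and let G be a P4-free simple graph. Then G has a spanning k-walk if and only if G is (1/k)-tough. -/

import Mathlib

open SimpleGraph

variable {V : Type*} {W : Type*}

/-- A graph is `P₄`-free if it contains no induced subgraph isomorphic to the
path on four vertices. -/
def P4Free (G : SimpleGraph V) : Prop := IsEmpty (SimpleGraph.pathGraph 4 ↪g G)

/-- `R` is (the vertex set of) a connected component of `G - S`:
a maximal subset of `V(G) - S` inducing a connected subgraph. -/
def IsCompOf (G : SimpleGraph V) (S R : Set V) : Prop :=
  R ⊆ Sᶜ ∧ (G.induce R).Connected ∧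
    ∀ R' : Set V, R ⊆ R' → R' ⊆ Sᶜ → (G.induce R').Connected → R' = R

/-- The number of connected components of `G - S`. -/
noncomputable def numComp (G : SimpleGraph V) (S : Set V) : ℕ :=
  {R : Set V | IsCompOf G S R}.ncard

/-- `S` is a cutset of `G` : the graph `G - S` is disconnected. -/
def IsCutset (G : SimpleGraph V) (S : Set V) : Prop := 2 ≤ numComp G S

/-- `G` is `t`-tough: for every cutset `S`, `t * c(G - S) ≤ |S|`. -/
def Tough (t : ℝ) (G : SimpleGraph V) : Prop :=
  ∀ S : Set V, IsCutset G S → t * (numComp G S : ℝ) ≤ (S.ncard : ℝ)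

/-- `t` is the toughness of `G` : the largest `s` such that `G` is `s`-tough.
(For a complete graph no such largest `s` exists; the toughness is infinite.) -/
def IsToughness (G : SimpleGraph V) (t : ℝ) : Prop :=
  Tough t G ∧ ∀ s : ℝ, Tough s G → s ≤ t

/-- `S` is a tough-set of `G` (whose toughness is `t`): a cutset with
`|S| = t * c(G - S)`. -/
def ToughSet (G : SimpleGraph V) (t : ℝ) (S : Set V) : Prop :=
  IsCutset G S ∧ (S.ncard : ℝ) = t * (numComp G S : ℝ)

/-- Vertex `u` is adjacent in `G` to some vertex of the set `R`. -/
def AdjToSet (G : SimpleGraph V) (u : V) (R : Set V) : Prop := ∃ v ∈ R, G.Adj u v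

/-- `G` has a Hamiltonian cycle. -/
def HasHamCycle [DecidableEq V] (G : SimpleGraph V) : Prop :=
  ∃ (v : V) (w : G.Walk v v), w.IsHamiltonianCycle

/-- `G` has a spanning `k`-walk: a closed walk visiting every vertex at least once
and at most `k` times.  (In a nontrivial closed walk the base vertex occurs one
extra time in `Walk.support`, whence the correction term.) -/
def HasSpanningKWalk [DecidableEq V] (G : SimpleGraph V) (k : ℕ) : Prop :=
  ∃ (v : V) (w : G.Walk v v), (∀ x : V, x ∈ w.support) ∧
    ∀ x : V, w.support.count x ≤ k + (if x = v then 1 else 0)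

/-- The prism over `G`: the Cartesian (box) product `G □ K₂`. -/
def prism (G : SimpleGraph V) : SimpleGraph (V × Fin 2) :=
  G.boxProd (⊤ : SimpleGraph (Fin 2))

/-- The graph obtained from `G` by contracting the set `R` to a single vertex
(namely `Sum.inr ()`), which is adjacent to exactly those vertices outside `R`
having a neighbor in `R`. -/
def contractSet (G : SimpleGraph V) (R : Set V) : SimpleGraph (↥(Rᶜ) ⊕ Unit) :=
  SimpleGraph.fromRel fun x y =>
    match x, y with
    | Sum.inl a, Sum.inl b => G.Adj ↑a ↑b
    | Sum.inl a, Sum.inr _ => ∃ r ∈ R, G.Adj ↑a r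
    | _, _ => False

/-- `v` is a cutvertex of `H` : deleting `v` leaves a disconnected
(non-preconnected) graph. -/
def IsCutvertex (H : SimpleGraph W) (v : W) : Prop :=
  ¬ (H.induce ({v}ᶜ : Set W)).Preconnected

/-- `B` is a block of `H` : a maximal connected subgraph having no cutvertex of
its own. -/
def IsBlock (H : SimpleGraph W) (B : H.Subgraph) : Prop :=
  B.coe.Connected ∧ (∀ v, ¬ IsCutvertex B.coe v) ∧
    ∀ B' : H.Subgraph, B ≤ B' → B'.coe.Connected →
      (∀ v, ¬ IsCutvertex B'.coe v) → B' = B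

/-- `H` is a cycle of even length. -/
def IsEvenCycleGraph (H : SimpleGraph W) : Prop :=
  ∃ n : ℕ, Even n ∧ 3 ≤ n ∧ Nonempty (H ≃g SimpleGraph.cycleGraph n)

/-- `H` is a single edge. -/
def IsSingleEdgeGraph (H : SimpleGraph W) : Prop :=
  ∃ u v : W, u ≠ v ∧ H.Adj u v ∧ ∀ w : W, w = u ∨ w = v

/-- `H` is a simple block EP (SBEP) graph: a connected graph in which every block
is an even cycle or a single edge, and every vertex lies in at most two blocks. -/
def IsSBEP (H : SimpleGraph W) : Prop :=
  H.Connected ∧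
    (∀ B : H.Subgraph, IsBlock H B → IsEvenCycleGraph B.coe ∨ IsSingleEdgeGraph B.coe) ∧
    ∀ (v : W) (B₁ B₂ B₃ : H.Subgraph),
      IsBlock H B₁ ∧ v ∈ B₁.verts → IsBlock H B₂ ∧ v ∈ B₂.verts →
      IsBlock H B₃ ∧ v ∈ B₃.verts → B₁ = B₂ ∨ B₁ = B₃ ∨ B₂ = B₃

/-- `v` is a single-block vertex of `H` : it lies in exactly one block. -/
def SingleBlockVertex (H : SimpleGraph W) (v : W) : Prop :=
  ∃! B : H.Subgraph, IsBlock H B ∧ v ∈ B.verts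

section Components

/-- Inducing on a subset of a subset agrees with inducing on its image. -/
noncomputable def induceInduceIso (G : SimpleGraph V) (S : Set V) (R : Set S) :
    (G.induce S).induce R ≃g G.induce (Subtype.val '' R) where
  toEquiv := Equiv.Set.image Subtype.val R Subtype.val_injective
  map_rel_iff' := Iff.rfl

theorem isCompOf_image_iff (G : SimpleGraph V) (S : Set V) (R : Set ↥(Sᶜ)) :
    IsCompOf G S (Subtype.val '' R) ↔
      ∃ C : (G.induce Sᶜ).ConnectedComponent, C.supp = R := by
  rw [← ConnectedComponent.maximal_connected_induce_iff]
  constructor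
  · rintro ⟨-, hc, hmax⟩
    refine ⟨(induceInduceIso G Sᶜ R).connected_iff.2 hc, fun R' hR' hle => ?_⟩
    have h := hmax (Subtype.val '' R') (Set.image_mono hle) (by simp)
      ((induceInduceIso G Sᶜ R').connected_iff.1 hR')
    exact (Subtype.val_injective.image_injective h).le
  · rintro ⟨hc, hmax⟩
    refine ⟨by simp, (induceInduceIso G Sᶜ R).connected_iff.1 hc, fun R' hle hR' hc' => ?_⟩
    obtain ⟨R', rfl⟩ : ∃ T : Set ↥(Sᶜ), Subtype.val '' T = R' :=
      ⟨Subtype.val ⁻¹' R', by simpa using hR'⟩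
    have hle' : R ⊆ R' := (Set.image_subset_image_iff Subtype.val_injective).1 hle
    have h := hmax ((induceInduceIso G Sᶜ R').connected_iff.2 hc') hle'
    rw [Set.Subset.antisymm hle' h]

theorem numComp_eq_card (G : SimpleGraph V) (S : Set V) :
    numComp G S = Nat.card (G.induce Sᶜ).ConnectedComponent := by
  have h : {R : Set V | IsCompOf G S R} =
      Set.range fun C : (G.induce Sᶜ).ConnectedComponent => Subtype.val '' C.supp := by
    ext R
    constructor
    · intro hR
      obtain ⟨R, rfl⟩ : ∃ T : Set ↥(Sᶜ), Subtype.val '' T = R :=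
        ⟨Subtype.val ⁻¹' R, by simpa using hR.1⟩
      obtain ⟨C, rfl⟩ := (isCompOf_image_iff G S R).1 hR
      exact ⟨C, rfl⟩
    · rintro ⟨C, rfl⟩
      exact (isCompOf_image_iff G S _).2 ⟨C, rfl⟩
  rw [numComp, h, ← Nat.card_coe_set_eq, Nat.card_range_of_injective]
  exact Subtype.val_injective.image_injective.comp ConnectedComponent.supp_injective

/-- The subgraph induced on `X` splits into at least `n` parts with no edges between them, the
parts being the fibres of a labelling of `X` by elements of `X`. -/
def SplitsInto [DecidableEq V] (G : SimpleGraph V) (X : Finset V) (n : ℕ) : Prop :=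
  ∃ f : V → V, (∀ v ∈ X, f v ∈ X) ∧ (∀ u ∈ X, ∀ v ∈ X, G.Adj u v → f u = f v) ∧
    n ≤ (X.image f).card

variable [DecidableEq V] {G : SimpleGraph V}

theorem SplitsInto.mono {X : Finset V} {m n : ℕ} (h : SplitsInto G X n) (hmn : m ≤ n) :
    SplitsInto G X m := by
  obtain ⟨f, h1, h2, h3⟩ := h
  exact ⟨f, h1, h2, hmn.trans h3⟩

theorem splitsInto_one {X : Finset V} (hX : X.Nonempty) : SplitsInto G X 1 := by
  obtain ⟨x, hx⟩ := hX
  exact ⟨fun _ => x, fun _ _ => hx, fun _ _ _ _ _ => rfl,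
    Finset.one_le_card.2 ⟨x, Finset.mem_image.2 ⟨x, hx, rfl⟩⟩⟩

theorem SplitsInto.union {X Y : Finset V} {m n : ℕ} (hX : SplitsInto G X m)
    (hY : SplitsInto G Y n) (hXY : Disjoint X Y) (hadj : ∀ x ∈ X, ∀ y ∈ Y, ¬ G.Adj x y) :
    SplitsInto G (X ∪ Y) (m + n) := by
  obtain ⟨f, f1, f2, f3⟩ := hX
  obtain ⟨g, g1, g2, g3⟩ := hY
  have hnot : ∀ y ∈ Y, y ∉ X := fun y hy hx => Finset.disjoint_left.1 hXY hx hy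
  refine ⟨fun v => if v ∈ X then f v else g v, ?_, ?_, ?_⟩
  · intro v hv
    by_cases h : v ∈ X
    · simp [h, f1 v h]
    · have hvY : v ∈ Y := by simpa [h] using hv
      simp [h, g1 v hvY]
  · intro u hu v hv huv
    rcases Finset.mem_union.1 hu with hu | hu <;> rcases Finset.mem_union.1 hv with hv | hv
    · simp [hu, hv, f2 u hu v hv huv]
    · exact absurd huv (hadj u hu v hv)
    · exact absurd huv.symm (hadj v hv u hu)
    · simp [hnot u hu, hnot v hv, g2 u hu v hv huv]
  · have h1 : X.image (fun v => if v ∈ X then f v else g v) = X.image f :=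
      Finset.image_congr fun v hv => if_pos hv
    have h2 : Y.image (fun v => if v ∈ X then f v else g v) = Y.image g :=
      Finset.image_congr fun v hv => if_neg (hnot v hv)
    rw [Finset.image_union, h1, h2, Finset.card_union_of_disjoint]
    · omega
    · rw [Finset.disjoint_left]
      intro a ha hb
      obtain ⟨x, hx, rfl⟩ := Finset.mem_image.1 ha
      obtain ⟨y, hy, hxy⟩ := Finset.mem_image.1 hb
      exact hnot _ (g1 y hy) (hxy ▸ f1 x hx)

theorem SplitsInto.le_numComp [Fintype V] {S : Finset V} {n : ℕ}
    (h : SplitsInto G (Finset.univ \ S) n) : n ≤ numComp G S := by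
  classical
  obtain ⟨f, -, h2, h3⟩ := h
  rw [numComp_eq_card, Nat.card_eq_fintype_card]
  refine h3.trans ?_
  have hwalk : ∀ (u v : ↥((S : Set V)ᶜ)), (G.induce (S : Set V)ᶜ).Walk u v → f u = f v := by
    intro u v p
    induction p with
    | nil => rfl
    | @cons a b _ hadj _ ih =>
      rw [← ih]
      have ha : (a : V) ∉ S := a.2
      have hb : (b : V) ∉ S := b.2
      exact h2 _ (by simpa using ha) _ (by simpa using hb) hadj
  let F : (G.induce (S : Set V)ᶜ).ConnectedComponent → V :=
    ConnectedComponent.lift (fun v => f v) fun u v p _ => hwalk u v p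
  refine (Finset.card_le_card (t := Finset.univ.image F) ?_).trans Finset.card_image_le
  intro a ha
  obtain ⟨x, hx, rfl⟩ := Finset.mem_image.1 ha
  exact Finset.mem_image.2
    ⟨(G.induce (S : Set V)ᶜ).connectedComponentMk ⟨x, by simpa using hx⟩, Finset.mem_univ _, rfl⟩

end Components

section Necessity

/-- Along a chain ending in `S`, the number of labels seen outside `S` is bounded by the number of
visits to `S`, provided that labels only change when passing through `S`. -/
theorem card_labels_add_le {α : Type*} [DecidableEq α] {G : SimpleGraph V} {S : Set V}
    [DecidablePred (· ∈ S)] (f : V → α)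
    (hf : ∀ u ∉ S, ∀ v ∉ S, G.Adj u v → f u = f v) (x : V) (t : List V)
    (hc : List.IsChain G.Adj (x :: t)) (hlast : ∀ y ∈ (x :: t).getLast?, y ∈ S) :
    (((x :: t).filter (· ∉ S)).map f).toFinset.card + (if x ∈ S then 1 else 0) ≤
      (x :: t).countP (· ∈ S) := by
  induction t generalizing x with
  | nil =>
    have hx : x ∈ S := hlast x (by simp)
    simp [hx]
  | cons y t ih =>
    rw [List.isChain_cons_cons] at hc
    have h := ih y hc.2 (by simpa using hlast)
    by_cases hx : x ∈ S
    · have h1 : (x :: y :: t).filter (· ∉ S) = (y :: t).filter (· ∉ S) := by simp [hx]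
      have h2 : (x :: y :: t).countP (· ∈ S) = (y :: t).countP (· ∈ S) + 1 := by
        rw [List.countP_cons]; simp [hx]
      rw [h1, h2, if_pos hx]
      omega
    · have h1 : (x :: y :: t).filter (· ∉ S) = x :: (y :: t).filter (· ∉ S) := by
        rw [List.filter_cons]; simp [hx]
      have h2 : (x :: y :: t).countP (· ∈ S) = (y :: t).countP (· ∈ S) := by
        rw [List.countP_cons]; simp [hx]
      rw [h1, h2, if_neg hx, List.map_cons, List.toFinset_cons]
      by_cases hy : y ∈ S
      · rw [if_pos hy] at h
        exact (Finset.card_insert_le _ _).trans h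
      · rw [if_neg hy] at h
        rw [Finset.insert_eq_of_mem]
        · exact h
        · rw [hf x hx y hy hc.1]
          simp [hy]

theorem HasSpanningKWalk.numComp_le [Fintype V] [DecidableEq V] {G : SimpleGraph V} {k : ℕ}
    (h : HasSpanningKWalk G k) (S : Set V) (hS : IsCutset G S) :
    numComp G S ≤ k * S.ncard := by
  classical
  obtain ⟨v, w, hw, hcount⟩ := h
  have htail : ∀ x, w.support.tail.count x ≤ k := by
    intro x
    have h := hcount x
    rw [← w.cons_tail_support, List.count_cons] at h
    by_cases hx : x = v
    · subst hx; simpa using h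
    · simpa [hx, Ne.symm hx] using h
  obtain ⟨s, hs⟩ : S.Nonempty := by
    by_contra hne
    have hall : ∀ x, x ∈ Sᶜ := fun x hx => hne ⟨x, hx⟩
    have hpre : (G.induce Sᶜ).Preconnected := fun x y =>
      ⟨((w.takeUntil x (hw x)).reverse.append (w.takeUntil y (hw y))).induce Sᶜ
        fun z _ => hall z⟩
    have := hpre.subsingleton_connectedComponent
    have h1 := Finite.card_le_one_iff_subsingleton.2 this
    rw [IsCutset, numComp_eq_card] at hS
    omega
  let f : V → Option (G.induce Sᶜ).ConnectedComponent := fun x =>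
    if hx : x ∈ Sᶜ then some ((G.induce Sᶜ).connectedComponentMk ⟨x, hx⟩) else none
  have hf : ∀ u ∉ S, ∀ v ∉ S, G.Adj u v → f u = f v := by
    intro u hu v hv huv
    have hu' : u ∈ Sᶜ := hu
    have hv' : v ∈ Sᶜ := hv
    have hadj : (G.induce Sᶜ).Adj ⟨u, hu'⟩ ⟨v, hv'⟩ := huv
    simp only [f, dif_pos hu', dif_pos hv']
    exact congrArg some (ConnectedComponent.sound hadj.reachable)
  let p := w.rotate s (hw s)
  have hp : ∀ x, x ∈ p.support := fun x => (w.mem_support_rotate_iff s (hw s)).2 (hw x)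
  have hchain := p.isChain_adj_support
  have hlast : ∀ y ∈ p.support.getLast?, y ∈ S := by
    intro y hy
    rw [List.getLast?_eq_getLast_of_ne_nil p.support_ne_nil, p.getLast_support] at hy
    simp only [Option.mem_some_iff] at hy
    exact hy ▸ hs
  have hmain : ((p.support.filter (· ∉ S)).map f).toFinset.card ≤
      p.support.tail.countP (· ∈ S) := by
    rw [← p.cons_tail_support] at hchain hlast ⊢
    have h := card_labels_add_le f hf s p.support.tail hchain hlast
    rw [if_pos hs, List.countP_cons] at h
    simpa [hs] using h
  have hlabels : numComp G S ≤ ((p.support.filter (· ∉ S)).map f).toFinset.card := by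
    rw [numComp_eq_card, Nat.card_eq_fintype_card, ← Finset.card_univ,
      ← Finset.card_image_of_injective Finset.univ (Option.some_injective _)]
    apply Finset.card_le_card
    intro a ha
    obtain ⟨C, -, rfl⟩ := Finset.mem_image.1 ha
    induction C using ConnectedComponent.ind with
    | h x =>
      rw [List.mem_toFinset, List.mem_map]
      refine ⟨x, ?_, dif_pos x.2⟩
      have hx : (x : V) ∉ S := x.2
      simp [hp, hx]
  have hvisits : p.support.tail.countP (· ∈ S) ≤ k * S.ncard := by
    rw [List.countP_eq_length_filter, ← Multiset.coe_card,
      ← Multiset.sum_count_eq_card (s := S.toFinset) (by simp), Set.ncard_eq_toFinset_card',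
      mul_comm, ← smul_eq_mul]
    refine Finset.sum_le_card_nsmul _ _ _ fun x _ => ?_
    rw [Multiset.coe_count]
    refine (List.filter_sublist.count_le x).trans ?_
    rw [(w.support_rotate s (hw s)).perm.count_eq]
    exact htail x
  exact hlabels.trans (hmain.trans hvisits)

end Necessity

section Decomposition

/-- No four vertices `a, b, c, d` induce the path `a - b - c - d`. -/
def NoInducedP4 (G : SimpleGraph V) : Prop :=
  ∀ a b c d, G.Adj a b → G.Adj b c → G.Adj c d → ¬ G.Adj a c → ¬ G.Adj b d → ¬ G.Adj a d → False

theorem ne_of_induced_path {G : SimpleGraph V} {a b c d : V} (hab : G.Adj a b) (hcd : G.Adj c d)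
    (hac : ¬ G.Adj a c) (had : ¬ G.Adj a d) : a ≠ c ∧ b ≠ d ∧ a ≠ d := by
  refine ⟨?_, ?_, ?_⟩
  · rintro rfl; exact had hcd
  · rintro rfl; exact had hab
  · rintro rfl; exact hac hcd.symm

theorem P4Free.noInducedP4 {G : SimpleGraph V} (h : P4Free G) : NoInducedP4 G := by
  intro a b c d hab hbc hcd hac hbd had
  have hne := ne_of_induced_path hab hcd hac had
  have hadj : ∀ i j, G.Adj (![a, b, c, d] i) (![a, b, c, d] j) ↔ (pathGraph 4).Adj i j := by
    intro i j
    fin_cases i <;> fin_cases j <;>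
      simp [pathGraph_adj, hab, hbc, hcd, hac, hbd, had, hab.symm, hbc.symm, hcd.symm,
        G.adj_comm c a, G.adj_comm d b, G.adj_comm d a]
  refine h.false ⟨⟨![a, b, c, d], ?_⟩, fun {i j} => hadj i j⟩
  intro i j hij
  fin_cases i <;> fin_cases j <;>
    simp_all [hab.ne, hab.ne', hbc.ne, hbc.ne', hcd.ne, hcd.ne', hne.1.symm, hne.2.1.symm,
      hne.2.2.symm]

theorem NoInducedP4.compl {G : SimpleGraph V} (h : NoInducedP4 G) : NoInducedP4 Gᶜ := by
  intro a b c d hab hbc hcd hac hbd had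
  have hne := ne_of_induced_path hab hcd hac had
  simp only [compl_adj, not_and, not_not] at *
  exact h c a d b (hac hne.1).symm (had hne.2.2) (hbd hne.2.1).symm
    (fun h' => hcd.2 h') hab.2 (fun h' => hbc.2 h'.symm)

/-- `A` is the disjoint union of two nonempty sets with no edges of `G` between them. -/
def IsSeparated [DecidableEq V] (G : SimpleGraph V) (A : Finset V) : Prop :=
  ∃ B C : Finset V, B.Nonempty ∧ C.Nonempty ∧ Disjoint B C ∧ B ∪ C = A ∧
    ∀ b ∈ B, ∀ c ∈ C, ¬ G.Adj b c

variable [DecidableEq V] {G : SimpleGraph V}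

theorem isSeparated_insert_of_not_adj (hG : NoInducedP4 G) {x y : V} {B C : Finset V}
    (hxB : x ∉ B) (hxC : x ∉ C) (hC : C.Nonempty) (hBC : Disjoint B C)
    (hadj : ∀ b ∈ B, ∀ c ∈ C, ¬ G.Adj b c) (hy : y ∈ B) (hxy : ¬ G.Adj x y) :
    IsSeparated G (insert x (B ∪ C)) := by
  classical
  by_cases hw : ∃ w ∈ C, G.Adj x w
  · obtain ⟨w, hwC, hxw⟩ := hw
    refine ⟨B.filter (¬ G.Adj x ·), insert x (B.filter (G.Adj x ·) ∪ C),
      ⟨y, by simp [hy, hxy]⟩, Finset.insert_nonempty _ _, ?_, ?_, ?_⟩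
    · rw [Finset.disjoint_left]
      intro a ha ha'
      simp only [Finset.mem_filter, Finset.mem_insert, Finset.mem_union] at ha ha'
      rcases ha' with rfl | ha' | ha'
      · exact hxB ha.1
      · exact ha.2 ha'.2
      · exact Finset.disjoint_left.1 hBC ha.1 ha'
    · ext a
      simp only [Finset.mem_filter, Finset.mem_insert, Finset.mem_union]
      tauto
    · intro b hb c hc hbc
      simp only [Finset.mem_filter, Finset.mem_insert, Finset.mem_union] at hb hc
      rcases hc with rfl | hc | hc
      · exact hb.2 hbc.symm
      · exact hG b c x w hbc hc.2.symm hxw (fun h => hb.2 h.symm) (hadj c hc.1 w hwC)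
          (hadj b hb.1 w hwC)
      · exact hadj b hb.1 c hc hbc
  · refine ⟨insert x B, C, Finset.insert_nonempty _ _, hC, ?_, Finset.insert_union _ _ _, ?_⟩
    · exact Finset.disjoint_insert_left.2 ⟨hxC, hBC⟩
    · intro b hb c hc hbc
      rcases Finset.mem_insert.1 hb with rfl | hb
      · exact hw ⟨c, hc, hbc⟩
      · exact hadj b hb c hc hbc

theorem IsSeparated.insert_or (hG : NoInducedP4 G) {x : V} {A : Finset V} (hx : x ∉ A)
    (hA : IsSeparated G A) :
    IsSeparated G (insert x A) ∨ IsSeparated Gᶜ (insert x A) := by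
  obtain ⟨B, C, hB, hC, hBC, rfl, hadj⟩ := hA
  simp only [Finset.mem_union, not_or] at hx
  by_cases hall : ∀ y ∈ B ∪ C, G.Adj x y
  · right
    refine ⟨{x}, B ∪ C, by simp, hB.mono Finset.subset_union_left, by simp [hx], rfl, ?_⟩
    intro b hb c hc
    rw [Finset.mem_singleton.1 hb, compl_adj]
    exact fun h => h.2 (hall c hc)
  · left
    push Not at hall
    obtain ⟨y, hy, hxy⟩ := hall
    rcases Finset.mem_union.1 hy with hy | hy
    · exact isSeparated_insert_of_not_adj hG hx.1 hx.2 hC hBC hadj hy hxy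
    · rw [Finset.union_comm]
      exact isSeparated_insert_of_not_adj hG hx.2 hx.1 hB hBC.symm
        (fun b hb c hc h => hadj c hc b hb h.symm) hy hxy

/-- A set of at least two vertices of a `P₄`-free graph is separated in the graph or in its
complement. -/
theorem NoInducedP4.isSeparated_or (hG : NoInducedP4 G) (A : Finset V) (hA : 2 ≤ A.card) :
    IsSeparated G A ∨ IsSeparated Gᶜ A := by
  induction A using Finset.induction_on with
  | empty => simp at hA
  | insert x A hx ih =>
    rw [Finset.card_insert_of_notMem hx] at hA
    rcases Nat.lt_or_ge A.card 2 with h | h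
    · obtain ⟨y, rfl⟩ := Finset.card_eq_one.1 (show A.card = 1 by omega)
      by_cases hxy : G.Adj x y
      · exact Or.inr ⟨{x}, {y}, by simp, by simp, by simpa using hx, rfl, by simp [hxy]⟩
      · exact Or.inl ⟨{x}, {y}, by simp, by simp, by simpa using hx, rfl, by simp [hxy]⟩
    · rcases ih h with h | h
      · exact h.insert_or hG hx
      · have := h.insert_or hG.compl hx
        rwa [compl_compl, or_comm] at this

end Decomposition

section PathCovers

/-- Vertices of `G` that are adjacent or equal: the steps of a lazy walk. -/
def LazyAdj (G : SimpleGraph V) (u v : V) : Prop := u = v ∨ G.Adj u v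

/-- `L` is a family of nonempty lazy paths inside `A`. -/
def IsLazyFamily (G : SimpleGraph V) (A : Finset V) (L : List (List V)) : Prop :=
  ∀ l ∈ L, l ≠ [] ∧ l.IsChain (LazyAdj G) ∧ ∀ x ∈ l, x ∈ A

/-- There are `m` nonempty lazy paths that together visit each vertex of `A` exactly `k` times
and visit no other vertex. -/
def LazyCover (G : SimpleGraph V) (k : ℕ) (A : Finset V) (m : ℕ) : Prop :=
  ∃ L : List (List V), L.length = m ∧ IsLazyFamily G A L ∧
    (L.flatten : Multiset V) = k • A.val

variable {G : SimpleGraph V} {k : ℕ}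

theorem List.exists_split_flatten {r : V → V → Prop} {A : Finset V} (L : List (List V))
    (hL : ∀ l ∈ L, l ≠ [] ∧ l.IsChain r ∧ ∀ x ∈ l, x ∈ A) (hlen : L.length < L.flatten.length) :
    ∃ L' : List (List V), L'.length = L.length + 1 ∧
      (∀ l ∈ L', l ≠ [] ∧ l.IsChain r ∧ ∀ x ∈ l, x ∈ A) ∧ L'.flatten = L.flatten := by
  induction L with
  | nil => simp at hlen
  | cons l L ih =>
    have hl := hL l (by simp)
    have hL' : ∀ l ∈ L, l ≠ [] ∧ l.IsChain r ∧ ∀ x ∈ l, x ∈ A :=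
      fun l' h => hL l' (List.mem_cons_of_mem _ h)
    match l, hl, hlen with
    | [], hl, _ => exact absurd rfl hl.1
    | [x], hl, hlen =>
      obtain ⟨L', h1, h2, h3⟩ := ih hL' (by simp at hlen ⊢; omega)
      refine ⟨[x] :: L', by simp [h1], ?_, by simp [h3]⟩
      intro l' h'
      rcases List.mem_cons.1 h' with rfl | h'
      · exact hl
      · exact h2 l' h'
    | x :: y :: t, hl, _ =>
      refine ⟨[x] :: (y :: t) :: L, by simp, ?_, by simp⟩
      intro l' h'
      rcases List.mem_cons.1 h' with rfl | h'
      · exact ⟨by simp, by simp, by simpa using hl.2.2 x (by simp)⟩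
      rcases List.mem_cons.1 h' with rfl | h'
      · exact ⟨by simp, hl.2.1.tail, fun z hz => hl.2.2 z (List.mem_cons_of_mem _ hz)⟩
      · exact hL' l' h'

theorem LazyCover.le_mul_card {A : Finset V} {m : ℕ} (h : LazyCover G k A m) :
    m ≤ k * A.card := by
  obtain ⟨L, rfl, hL, hk⟩ := h
  have hcard := congrArg Multiset.card hk
  rw [Multiset.coe_card, Multiset.card_nsmul, Finset.card_val] at hcard
  rw [← hcard, List.length_flatten]
  have := List.length_le_sum_of_one_le (L.map List.length) (by
    intro n hn
    obtain ⟨l, hl, rfl⟩ := List.mem_map.1 hn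
    exact List.length_pos_iff.2 (hL l hl).1)
  simpa using this

theorem LazyCover.mono {A : Finset V} {m n : ℕ} (h : LazyCover G k A m) (hmn : m ≤ n)
    (hn : n ≤ k * A.card) : LazyCover G k A n := by
  induction n, hmn using Nat.le_induction with
  | base => exact h
  | succ n _ ih =>
    obtain ⟨L, hlen, hL, hk⟩ := ih (by omega)
    have hcard := congrArg Multiset.card hk
    rw [Multiset.coe_card, Multiset.card_nsmul, Finset.card_val] at hcard
    obtain ⟨L', h1, h2, h3⟩ := List.exists_split_flatten L hL (by omega)
    exact ⟨L', by omega, h2, by rw [h3, hk]⟩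

theorem IsLazyFamily.mono {A B : Finset V} {L : List (List V)} (h : IsLazyFamily G A L)
    (hAB : A ⊆ B) : IsLazyFamily G B L :=
  fun l hl => ⟨(h l hl).1, (h l hl).2.1, fun x hx => hAB ((h l hl).2.2 x hx)⟩

theorem nsmul_union_val [DecidableEq V] {A B : Finset V} (hAB : Disjoint A B) :
    k • (A ∪ B).val = k • A.val + k • B.val := by
  rw [← Finset.disjUnion_eq_union A B hAB, Finset.disjUnion_val, nsmul_add]

theorem LazyCover.union [DecidableEq V] {A B : Finset V} {m n : ℕ} (hA : LazyCover G k A m)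
    (hB : LazyCover G k B n) (hAB : Disjoint A B) : LazyCover G k (A ∪ B) (m + n) := by
  obtain ⟨L, rfl, hL, hLk⟩ := hA
  obtain ⟨M, rfl, hM, hMk⟩ := hB
  refine ⟨L ++ M, by simp, ?_, ?_⟩
  · intro l hl
    rcases List.mem_append.1 hl with hl | hl
    · exact hL.mono Finset.subset_union_left l hl
    · exact hM.mono Finset.subset_union_right l hl
  · rw [List.flatten_append, ← Multiset.coe_add, hLk, hMk, nsmul_union_val hAB]

theorem lazyCover_singleton (hk : 1 ≤ k) (x : V) : LazyCover G k {x} 1 := by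
  refine ⟨[List.replicate k x], rfl, ?_, ?_⟩
  · intro l hl
    rw [List.mem_singleton.1 hl]
    refine ⟨by simp; omega, List.isChain_replicate_of_rel k (Or.inl rfl), ?_⟩
    intro y hy
    simpa using (List.mem_replicate.1 hy).2
  · simp [Multiset.nsmul_singleton, Multiset.coe_replicate]

/-- Two equally long nonempty families of lazy paths inside completely joined sets can be
interleaved. -/
theorem IsLazyFamily.exists_interleave {A B : Finset V}
    (hjoin : ∀ a ∈ A, ∀ b ∈ B, G.Adj a b) (L M : List (List V)) (hL : IsLazyFamily G A L)
    (hM : IsLazyFamily G B M) (hlen : L.length = M.length) (hne : L ≠ []) :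
    ∃ l : List V, l ≠ [] ∧ l.IsChain (LazyAdj G) ∧ (∀ a ∈ l.head?, a ∈ A) ∧
      (∀ b ∈ l.getLast?, b ∈ B) ∧ (l : Multiset V) = L.flatten + M.flatten := by
  induction L generalizing M with
  | nil => exact absurd rfl hne
  | cons a L ih =>
    match M, hM, hlen with
    | b :: M, hM, hlen =>
      obtain ⟨ha, hac, haA⟩ := hL a (by simp)
      obtain ⟨hb, hbc, hbB⟩ := hM b (by simp)
      have hL' : IsLazyFamily G A L := fun l hl => hL l (List.mem_cons_of_mem _ hl)
      have hM' : IsLazyFamily G B M := fun l hl => hM l (List.mem_cons_of_mem _ hl)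
      have hab : (a ++ b).IsChain (LazyAdj G) := List.isChain_append.2 ⟨hac, hbc,
        fun x hx y hy => Or.inr (hjoin x (haA x (List.mem_of_getLast? hx)) y
          (hbB y (List.mem_of_head? hy)))⟩
      have hhead : ∀ (t : List V), ∀ x ∈ (a ++ b ++ t).head?, x ∈ A := by
        intro t x hx
        rw [List.append_assoc, List.head?_append_of_ne_nil _ ha] at hx
        exact haA x (List.mem_of_head? hx)
      have hlast : ∀ y ∈ (a ++ b).getLast?, y ∈ B := by
        intro y hy
        rw [List.getLast?_append_of_ne_nil _ hb] at hy
        exact hbB y (List.mem_of_getLast? hy)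
      by_cases hLn : L = []
      · subst hLn
        obtain rfl : M = [] := by simpa using hlen.symm
        exact ⟨a ++ b, by simp [ha], hab, by simpa using hhead [], hlast, by simp⟩
      · obtain ⟨l, h1, h2, h3, h4, h5⟩ := ih M hL' hM' (by simpa using hlen) hLn
        refine ⟨a ++ b ++ l, by simp [ha], ?_, hhead l, ?_, ?_⟩
        · exact List.isChain_append.2 ⟨hab, h2,
            fun x hx y hy => Or.inr (hjoin y (h3 y hy) x (hlast x hx)).symm⟩
        · intro y hy
          rw [List.getLast?_append_of_ne_nil _ h1] at hy
          exact h4 y hy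
        · rw [← Multiset.coe_add, ← Multiset.coe_add, h5, List.flatten_cons, List.flatten_cons,
            ← Multiset.coe_add, ← Multiset.coe_add]
          abel

variable [DecidableEq V]

theorem LazyCover.exists_cycle {A B : Finset V} {m : ℕ} (hm : 1 ≤ m)
    (hA : LazyCover G k A m) (hB : LazyCover G k B m) (hAB : Disjoint A B)
    (hjoin : ∀ a ∈ A, ∀ b ∈ B, G.Adj a b) :
    ∃ l : List V, l ≠ [] ∧ l.IsChain (LazyAdj G) ∧ (∀ a ∈ l.head?, a ∈ A) ∧
      (∀ b ∈ l.getLast?, b ∈ B) ∧ (l : Multiset V) = k • (A ∪ B).val := by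
  obtain ⟨L, hLm, hL, hLk⟩ := hA
  obtain ⟨M, hMm, hM, hMk⟩ := hB
  obtain ⟨l, h1, h2, h3, h4, h5⟩ := hL.exists_interleave hjoin L M hM (by omega)
    (List.ne_nil_of_length_pos (by omega))
  exact ⟨l, h1, h2, h3, h4, by rw [h5, hLk, hMk, nsmul_union_val hAB]⟩

theorem LazyCover.join_one {A B : Finset V} {m : ℕ} (hm : 1 ≤ m)
    (hA : LazyCover G k A m) (hB : LazyCover G k B m) (hAB : Disjoint A B)
    (hjoin : ∀ a ∈ A, ∀ b ∈ B, G.Adj a b) : LazyCover G k (A ∪ B) 1 := by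
  obtain ⟨l, h1, h2, -, -, h5⟩ := hA.exists_cycle hm hB hAB hjoin
  refine ⟨[l], rfl, ?_, by simpa using h5⟩
  intro l' hl'
  obtain rfl := List.mem_singleton.1 hl'
  refine ⟨h1, h2, fun x hx => ?_⟩
  rw [← Multiset.mem_coe, h5] at hx
  exact Multiset.mem_of_mem_nsmul hx

theorem LazyCover.join_sub {A B : Finset V} {a b : ℕ} (ha : 1 ≤ a) (hab : a < b)
    (hA : LazyCover G k A a) (hB : LazyCover G k B b) (hAB : Disjoint A B)
    (hjoin : ∀ a ∈ A, ∀ b ∈ B, G.Adj a b) : LazyCover G k (A ∪ B) (b - a) := by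
  obtain ⟨L, hLm, hL, hLk⟩ := hA
  obtain ⟨M, hMm, hM, hMk⟩ := hB
  have hsplit := List.take_append_drop a M
  have hdrop : (M.drop a).length = b - a := by simp [hMm]
  match hN : M.drop a with
  | [] => simp [hN] at hdrop; omega
  | c :: N =>
    rw [hN] at hsplit hdrop
    have hM1 : IsLazyFamily G B (M.take a) := fun l hl => hM l (List.mem_of_mem_take hl)
    have hM2 : IsLazyFamily G B (c :: N) :=
      fun l hl => hM l (List.mem_of_mem_drop (hN ▸ hl))
    obtain ⟨l, h1, h2, h3, -, h5⟩ := hL.exists_interleave hjoin L (M.take a) hM1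
      (by simp; omega) (List.ne_nil_of_length_pos (by omega))
    obtain ⟨hc, hcc, hcB⟩ := hM2 c (by simp)
    refine ⟨(c ++ l) :: N, by simpa using hdrop, ?_, ?_⟩
    · intro l' hl'
      rcases List.mem_cons.1 hl' with rfl | hl'
      · refine ⟨by simp [hc], List.isChain_append.2 ⟨hcc, h2, fun x hx y hy =>
          Or.inr (hjoin y (h3 y hy) x (hcB x (List.mem_of_getLast? hx))).symm⟩, ?_⟩
        intro x hx
        rcases List.mem_append.1 hx with hx | hx
        · exact Finset.mem_union_right _ (hcB x hx)
        · rw [← Multiset.mem_coe, h5] at hx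
          rcases Multiset.mem_add.1 hx with hx | hx
          · rw [hLk] at hx
            exact Finset.mem_union_left _ (Multiset.mem_of_mem_nsmul hx)
          · obtain ⟨l', hl', hx⟩ := List.mem_flatten.1 (Multiset.mem_coe.1 hx)
            exact Finset.mem_union_right _ ((hM1 l' hl').2.2 x hx)
      · exact hM2.mono Finset.subset_union_right l' (List.mem_cons_of_mem _ hl')
    · rw [nsmul_union_val hAB, ← hLk, ← hMk, ← hsplit, List.flatten_cons, List.flatten_append,
        List.flatten_cons, ← Multiset.coe_add, ← Multiset.coe_add, ← Multiset.coe_add,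
        ← Multiset.coe_add, h5]
      abel

/-- A cover by `m` lazy paths, optimal because deleting `S` leaves at least `m + k * |S|` parts. -/
def OptimalCover (G : SimpleGraph V) (k : ℕ) (A S : Finset V) (m : ℕ) : Prop :=
  1 ≤ m ∧ S ⊆ A ∧ LazyCover G k A m ∧ SplitsInto G (A \ S) (m + k * S.card)

theorem LazyCover.optimalCover_one {A : Finset V} (hA : A.Nonempty) (h : LazyCover G k A 1) :
    OptimalCover G k A ∅ 1 :=
  ⟨le_rfl, by simp, h, by simpa using splitsInto_one hA⟩

theorem OptimalCover.union {B C S T : Finset V} {b c : ℕ} (hB : OptimalCover G k B S b)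
    (hC : OptimalCover G k C T c) (hBC : Disjoint B C) (hadj : ∀ b ∈ B, ∀ c ∈ C, ¬ G.Adj b c) :
    OptimalCover G k (B ∪ C) (S ∪ T) (b + c) := by
  obtain ⟨hb, hS, hB, hBs⟩ := hB
  obtain ⟨hc, hT, hC, hCs⟩ := hC
  refine ⟨by omega, Finset.union_subset_union hS hT, hB.union hC hBC, ?_⟩
  have hsd : (B ∪ C) \ (S ∪ T) = B \ S ∪ C \ T := by
    ext x
    have h1 : x ∈ B → x ∉ C := fun h => Finset.disjoint_left.1 hBC h
    have h2 := @hS x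
    have h3 := @hT x
    simp only [Finset.mem_sdiff, Finset.mem_union]
    tauto
  rw [hsd, Finset.card_union_of_disjoint (Finset.disjoint_of_subset_left hS
    (Finset.disjoint_of_subset_right hT hBC))]
  refine (hBs.union hCs (Finset.disjoint_of_subset_left Finset.sdiff_subset
    (Finset.disjoint_of_subset_right Finset.sdiff_subset hBC)) ?_).mono (by rw [mul_add]; omega)
  exact fun x hx y hy => hadj x (Finset.mem_sdiff.1 hx).1 y (Finset.mem_sdiff.1 hy).1

theorem splitsInto_union_sdiff {A B S : Finset V} {n : ℕ} (hAB : Disjoint A B)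
    (h : SplitsInto G (A \ S) n) : SplitsInto G ((A ∪ B) \ (S ∪ B)) n := by
  have hsd : (A ∪ B) \ (S ∪ B) = A \ S := by
    ext x
    have h1 : x ∈ A → x ∉ B := fun h => Finset.disjoint_left.1 hAB h
    simp only [Finset.mem_sdiff, Finset.mem_union]
    tauto
  rwa [hsd]

theorem OptimalCover.join_of_lt {B C S : Finset V} {b : ℕ} (hk : 1 ≤ k)
    (hB : OptimalCover G k B S b) (hC : C.Nonempty) (hCk : LazyCover G k C (k * C.card))
    (hBC : Disjoint B C) (hjoin : ∀ b ∈ B, ∀ c ∈ C, G.Adj b c) (hlt : k * C.card < b) :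
    OptimalCover G k (B ∪ C) (S ∪ C) (b - k * C.card) := by
  obtain ⟨-, hS, hB, hBs⟩ := hB
  refine ⟨by omega, Finset.union_subset_union_left hS, ?_, ?_⟩
  · rw [Finset.union_comm]
    exact hCk.join_sub (Nat.mul_pos hk hC.card_pos) hlt hB hBC.symm
      fun c hc b hb => (hjoin b hb c hc).symm
  · refine (splitsInto_union_sdiff hBC hBs).mono ?_
    rw [Finset.card_union_of_disjoint (Finset.disjoint_of_subset_left hS hBC), mul_add]
    omega

theorem IsSeparated.exists_join {A : Finset V} (h : IsSeparated Gᶜ A) :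
    ∃ B C : Finset V, B.Nonempty ∧ C.Nonempty ∧ Disjoint B C ∧ B ∪ C = A ∧
      ∀ b ∈ B, ∀ c ∈ C, G.Adj b c := by
  obtain ⟨B, C, hB, hC, hBC, hA, hadj⟩ := h
  refine ⟨B, C, hB, hC, hBC, hA, fun b hb c hc => ?_⟩
  by_contra hbc
  exact hadj b hb c hc
    ((compl_adj _ _ _).2 ⟨fun h => Finset.disjoint_left.1 hBC hb (h ▸ hc), hbc⟩)

theorem NoInducedP4.exists_optimalCover (hG : NoInducedP4 G) (hk : 1 ≤ k) (A : Finset V)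
    (hA : A.Nonempty) : ∃ S m, OptimalCover G k A S m := by
  induction A using Finset.strongInduction with
  | H A ih =>
    have hlt : ∀ {B C : Finset V}, B.Nonempty → C.Nonempty → Disjoint B C → B ∪ C = A →
        B ⊂ A ∧ C ⊂ A := by
      rintro B C ⟨b, hb⟩ ⟨c, hc⟩ hBC rfl
      exact ⟨Finset.ssubset_iff_subset_ne.2 ⟨Finset.subset_union_left, fun h =>
          Finset.disjoint_left.1 hBC (h ▸ Finset.mem_union_right _ hc) hc⟩,
        Finset.ssubset_iff_subset_ne.2 ⟨Finset.subset_union_right, fun h =>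
          Finset.disjoint_left.1 hBC hb (h ▸ Finset.mem_union_left _ hb)⟩⟩
    rcases Nat.lt_or_ge A.card 2 with h | h
    · obtain ⟨x, rfl⟩ := Finset.card_eq_one.1
        (show A.card = 1 by have := hA.card_pos; omega)
      exact ⟨∅, 1, (lazyCover_singleton hk x).optimalCover_one hA⟩
    rcases hG.isSeparated_or A h with hs | hs
    · obtain ⟨B, C, hB, hC, hBC, hU, hadj⟩ := hs
      obtain ⟨S, b, hSb⟩ := ih B (hlt hB hC hBC hU).1 hB
      obtain ⟨T, c, hTc⟩ := ih C (hlt hB hC hBC hU).2 hC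
      exact ⟨S ∪ T, b + c, hU ▸ hSb.union hTc hBC hadj⟩
    · obtain ⟨B, C, hB, hC, hBC, hU, hjoin⟩ := hs.exists_join
      obtain ⟨S, b, hSb⟩ := ih B (hlt hB hC hBC hU).1 hB
      obtain ⟨T, c, hTc⟩ := ih C (hlt hB hC hBC hU).2 hC
      have hBk := hSb.2.2.1.le_mul_card
      have hCk := hTc.2.2.1.le_mul_card
      rcases Nat.lt_or_ge (k * C.card) b with h1 | h1
      · exact ⟨_, _, hU ▸ hSb.join_of_lt hk hC (hTc.2.2.1.mono hCk le_rfl) hBC hjoin h1⟩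
      rcases Nat.lt_or_ge (k * B.card) c with h2 | h2
      · rw [Finset.union_comm] at hU
        exact ⟨_, _, hU ▸ hTc.join_of_lt hk hB (hSb.2.2.1.mono hBk le_rfl) hBC.symm
          (fun c hc b hb => (hjoin b hb c hc).symm) h2⟩
      · have hone := (hSb.2.2.1.mono (le_max_left b c) (max_le hBk h2)).join_one
          (hSb.1.trans (le_max_left b c))
          (hTc.2.2.1.mono (le_max_right b c) (max_le h1 hCk)) hBC hjoin
        rw [hU] at hone
        exact ⟨∅, 1, hone.optimalCover_one hA⟩

end PathCovers

section Sufficiency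

/-- A lazy chain can be turned into a walk by removing repetitions. -/
theorem exists_walk_of_isChain_lazyAdj {G : SimpleGraph V} (v : V) (t : List V)
    (h : (v :: t).IsChain (LazyAdj G)) {z : V} (hz : z ∈ (v :: t).getLast?) :
    ∃ w : G.Walk v z, w.support.Sublist (v :: t) ∧ ∀ x ∈ v :: t, x ∈ w.support := by
  induction t generalizing v with
  | nil =>
    obtain rfl : v = z := by simpa using hz
    exact ⟨Walk.nil, by simp, by simp⟩
  | cons u t ih =>
    rw [List.isChain_cons_cons] at h
    obtain ⟨w, h1, h2⟩ := ih u h.2 (by simpa using hz)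
    rcases h.1 with rfl | hadj
    · refine ⟨w, h1.cons _, ?_⟩
      intro x hx
      rcases List.mem_cons.1 hx with rfl | hx
      · exact h2 x (by simp)
      · exact h2 x hx
    · refine ⟨Walk.cons hadj w, ?_, ?_⟩
      · rw [Walk.support_cons]
        exact h1.cons_cons v
      · intro x hx
        rw [Walk.support_cons]
        rcases List.mem_cons.1 hx with rfl | hx
        · simp
        · exact List.mem_cons_of_mem _ (h2 x hx)

variable [Fintype V] [DecidableEq V] {G : SimpleGraph V} {k : ℕ}

theorem hasSpanningKWalk_of_lazy_cycle (hk : 1 ≤ k) {v : V} {t : List V}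
    (hc : (v :: t ++ [v]).IsChain (LazyAdj G))
    (hcount : ((v :: t : List V) : Multiset V) = k • (Finset.univ : Finset V).val) :
    HasSpanningKWalk G k := by
  obtain ⟨w, h1, h2⟩ := exists_walk_of_isChain_lazyAdj v (t ++ [v]) hc (z := v)
    (by rw [← List.cons_append, List.getLast?_concat]; rfl)
  have hx : ∀ x, (v :: t).count x = k := by
    intro x
    rw [← Multiset.coe_count, hcount, Multiset.count_nsmul,
      Multiset.count_eq_one_of_mem Finset.univ.nodup (Finset.mem_univ x), mul_one]
  refine ⟨v, w, ?_, ?_⟩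
  · intro x
    refine h2 x ?_
    rw [← List.cons_append, List.mem_append]
    exact Or.inl (List.count_pos_iff.1 (by rw [hx x]; omega))
  · intro x
    refine (h1.count_le x).trans ?_
    rw [← List.cons_append, List.count_append, hx x, List.count_singleton]
    by_cases h : x = v
    · simp [h]
    · simp [h, Ne.symm h]

theorem Tough.mul_ncard_ge (hk : 1 ≤ k) (hT : Tough (1 / (k : ℝ)) G) {S : Finset V} {n : ℕ}
    (hn : 2 ≤ n) (h : SplitsInto G (Finset.univ \ S) n) : n ≤ k * S.card := by
  have hle := h.le_numComp
  have h' := hT S (hn.trans hle)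
  have hk' : (0 : ℝ) < k := by exact_mod_cast hk
  rw [one_div, inv_mul_le_iff₀ hk', Set.ncard_coe_finset] at h'
  exact hle.trans (by exact_mod_cast h')

theorem OptimalCover.le_of_tough (hk : 1 ≤ k) (hT : Tough (1 / (k : ℝ)) G) {B C S : Finset V}
    {b : ℕ} (hB : OptimalCover G k B S b) (hC : C.Nonempty) (hBC : Disjoint B C)
    (hU : B ∪ C = Finset.univ) : b ≤ k * C.card := by
  obtain ⟨-, hS, -, hBs⟩ := hB
  by_contra! hlt
  have hpos : 0 < k * C.card := Nat.mul_pos hk hC.card_pos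
  have h := hT.mul_ncard_ge hk (by omega) (hU ▸ splitsInto_union_sdiff hBC hBs)
  rw [Finset.card_union_of_disjoint (Finset.disjoint_of_subset_left hS hBC), mul_add] at h
  omega

theorem NoInducedP4.hasSpanningKWalk [Nonempty V] (hG : NoInducedP4 G) (hk : 1 ≤ k)
    (hT : Tough (1 / (k : ℝ)) G) : HasSpanningKWalk G k := by
  rcases Nat.lt_or_ge (Finset.univ : Finset V).card 2 with h | h
  · obtain ⟨v⟩ := ‹Nonempty V›
    have := Finset.card_le_one.1 (show (Finset.univ : Finset V).card ≤ 1 by omega)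
    have hv : ∀ x : V, x = v := fun x => this x (Finset.mem_univ _) v (Finset.mem_univ _)
    exact ⟨v, Walk.nil, fun x => by simp [hv x], fun x => by simp [hv x]⟩
  rcases hG.isSeparated_or _ h with hs | hs
  · obtain ⟨B, C, hB, hC, hBC, hU, hadj⟩ := hs
    have h2 : SplitsInto G (Finset.univ \ ∅) 2 := by
      rw [Finset.sdiff_empty, ← hU]
      exact (splitsInto_one hB).union (splitsInto_one hC) hBC hadj
    have := hT.mul_ncard_ge hk le_rfl h2
    simp at this
  · obtain ⟨B, C, hB, hC, hBC, hU, hjoin⟩ := hs.exists_join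
    obtain ⟨S, b, hSb⟩ := hG.exists_optimalCover hk B hB
    obtain ⟨T, c, hTc⟩ := hG.exists_optimalCover hk C hC
    have hb := hSb.le_of_tough hk hT hC hBC hU
    have hc := hTc.le_of_tough hk hT hB hBC.symm (by rw [Finset.union_comm, hU])
    obtain ⟨l, h1, h2, h3, h4, h5⟩ := LazyCover.exists_cycle (hSb.1.trans (le_max_left b c))
      (hSb.2.2.1.mono (le_max_left b c) (max_le hSb.2.2.1.le_mul_card hc))
      (hTc.2.2.1.mono (le_max_right b c) (max_le hb hTc.2.2.1.le_mul_card)) hBC hjoin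
    rw [hU] at h5
    match l, h1 with
    | v :: t, _ =>
      refine hasSpanningKWalk_of_lazy_cycle hk (List.isChain_append.2 ⟨h2, by simp, ?_⟩) h5
      intro x hx y hy
      obtain rfl : v = y := by simpa using hy
      exact Or.inr (hjoin v (h3 v (by simp)) x (h4 x hx)).symm

end Sufficiency

/-- For `k ≥ 1`, a `P₄`-free graph has a spanning `k`-walk if and
only if it is `1/k`-tough. -/
theorem stmt_1 {V : Type*} [Fintype V] [DecidableEq V] [Nonempty V]
    (G : SimpleGraph V) (k : ℕ) (hk : 1 ≤ k) (hP4 : P4Free G) :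
    HasSpanningKWalk G k ↔ Tough (1 / (k : ℝ)) G := by
  refine ⟨fun h S hS => ?_, fun hT => hP4.noInducedP4.hasSpanningKWalk hk hT⟩
  have hk' : (0 : ℝ) < k := by exact_mod_cast hk
  rw [one_div, inv_mul_le_iff₀ hk']
  exact_mod_cast h.numComp_le S hS
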